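/- There exists a constant c > 0 such that for every real κ ≥ 1 and all λ, λ̃ ∈ (0, 1], |f(λ) − f(λ̃)|² + |g(λ) − g(λ̃)|² ≤ c · κ² · (λ − λ̃)² · (f(λ)² + g(λ)²). -/

import Mathlib

/-- The HHL filter function `f` (with `κ' = 2κ`). -/
noncomputable def hhlF (κ lam : ℝ) : ℝ :=
  if 1 / κ ≤ lam then 1 / (2 * κ * lam)
  else if 1 / (2 * κ) < lam then
    (1 / 2) * Real.sin ((Real.pi / 2) * (lam - 1 / (2 * κ)) / (1 / κ - 1 / (2 * κ)))
  else 0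

/-- The HHL filter function `g` (with `κ' = 2κ`). -/
noncomputable def hhlG (κ lam : ℝ) : ℝ :=
  if 1 / κ ≤ lam then 0
  else if 1 / (2 * κ) < lam then
    (1 / 2) * Real.cos ((Real.pi / 2) * (lam - 1 / (2 * κ)) / (1 / κ - 1 / (2 * κ)))
  else 1 / 2

noncomputable def hhlT (x : ℝ) : ℝ := Real.pi * (max (1/2) (min 1 x) - 1/2)

lemma hhlF_eq (κ l : ℝ) (hκ : 1 ≤ κ) :
    hhlF κ l = Real.sin (hhlT (κ * l)) / (2 * max 1 (κ * l)) := by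
  have hk : 0 < κ := by linarith
  unfold hhlF hhlT
  split_ifs with h1 h2
  · have h : 1 ≤ κ * l := by rwa [div_le_iff₀' hk] at h1
    rw [min_eq_left h, max_eq_right h, max_eq_right (by norm_num)]
    rw [show Real.pi * (1 - 1/2) = Real.pi / 2 by ring, Real.sin_pi_div_two, mul_assoc]
  · have h : κ * l < 1 := by rwa [not_le, lt_div_iff₀' hk] at h1
    have h' : 1/2 < κ * l := by rw [div_lt_iff₀' (by linarith)] at h2; linarith
    rw [min_eq_right h.le, max_eq_left h.le, max_eq_right h'.le]
    rw [show Real.pi / 2 * (l - 1 / (2 * κ)) / (1 / κ - 1 / (2 * κ)) = Real.pi * (κ * l - 1/2) by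
      rw [show 1 / κ - 1 / (2 * κ) = 1 / (2 * κ) by field_simp; norm_num]
      field_simp]
    ring
  · have h' : κ * l ≤ 1/2 := by
      rw [not_lt, le_div_iff₀' (by linarith)] at h2; linarith
    rw [min_eq_right (by linarith), max_eq_left h']
    simp

lemma hhlG_eq (κ l : ℝ) (hκ : 1 ≤ κ) :
    hhlG κ l = Real.cos (hhlT (κ * l)) / (2 * max 1 (κ * l)) := by
  have hk : 0 < κ := by linarith
  unfold hhlG hhlT
  split_ifs with h1 h2
  · have h : 1 ≤ κ * l := by rwa [div_le_iff₀' hk] at h1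
    rw [min_eq_left h, max_eq_right h, max_eq_right (by norm_num)]
    rw [show Real.pi * (1 - 1/2) = Real.pi / 2 by ring, Real.cos_pi_div_two, zero_div]
  · have h : κ * l < 1 := by rwa [not_le, lt_div_iff₀' hk] at h1
    have h' : 1/2 < κ * l := by rw [div_lt_iff₀' (by linarith)] at h2; linarith
    rw [min_eq_right h.le, max_eq_left h.le, max_eq_right h'.le]
    rw [show Real.pi / 2 * (l - 1 / (2 * κ)) / (1 / κ - 1 / (2 * κ)) = Real.pi * (κ * l - 1/2) by
      rw [show 1 / κ - 1 / (2 * κ) = 1 / (2 * κ) by field_simp; norm_num]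
      field_simp]
    ring
  · have h' : κ * l ≤ 1/2 := by
      rw [not_lt, le_div_iff₀' (by linarith)] at h2; linarith
    rw [min_eq_right (by linarith), max_eq_left h', max_eq_left (by linarith)]
    simp

lemma hhlT_lip (x y : ℝ) : |hhlT x - hhlT y| ≤ 4 * |x - y| := by
  unfold hhlT
  rw [← mul_sub, abs_mul, abs_of_pos Real.pi_pos]
  have h : |max (1/2) (min 1 x) - 1/2 - (max (1/2) (min 1 y) - 1/2)| ≤ |x - y| := by
    rw [sub_sub_sub_cancel_right]
    refine (abs_max_sub_max_le_max _ _ _ _).trans ?_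
    have := abs_min_sub_min_le_max 1 x 1 y
    simp at this ⊢
    exact this
  exact mul_le_mul Real.pi_le_four h (abs_nonneg _) (by norm_num)

lemma hhl_sin_lip (x y : ℝ) : |Real.sin x - Real.sin y| ≤ |x - y| := by
  rw [Real.sin_sub_sin, abs_mul, abs_mul, abs_two]
  have h1 := Real.abs_cos_le_one ((x + y) / 2)
  have h2 := Real.abs_sin_le_abs (x := (x - y) / 2)
  rw [abs_div, abs_two] at h2
  nlinarith [abs_nonneg (Real.sin ((x - y) / 2))]

lemma hhl_cos_lip (x y : ℝ) : |Real.cos x - Real.cos y| ≤ |x - y| := by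
  rw [← Real.sin_pi_div_two_sub, ← Real.sin_pi_div_two_sub]
  refine (hhl_sin_lip _ _).trans (le_of_eq ?_)
  rw [sub_sub_sub_cancel_left, abs_sub_comm]

lemma hhl_key (s s' m m' D : ℝ) (hs : |s - s'| ≤ 4 * D) (hs' : |s'| ≤ 1) (hm : 1 ≤ m)
    (hm' : 1 ≤ m') (hD : |m - m'| ≤ D) :
    |s / (2 * m) - s' / (2 * m')| ^ 2 ≤ 25 * D ^ 2 * (1 / (2 * m)) ^ 2 := by
  have h0 : 0 < m := by linarith
  have h0' : 0 < m' := by linarith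
  have e : s / (2 * m) - s' / (2 * m') = (s - s' + s' / m' * (m' - m)) * (1 / (2 * m)) := by
    field_simp; ring
  have h1 : |s' / m'| ≤ 1 := by
    rw [abs_div, abs_of_pos h0', div_le_one h0']; linarith
  have h2 : |s - s' + s' / m' * (m' - m)| ≤ 5 * D := by
    refine (abs_add_le _ _).trans ?_
    rw [abs_mul, abs_sub_comm m' m]
    nlinarith [abs_nonneg (m - m')]
  rw [e, sq_abs, mul_pow]
  have h3 := sq_le_sq' (abs_le.1 h2).1 (abs_le.1 h2).2
  nlinarith [sq_nonneg (1 / (2 * m))]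

theorem filter_function_error_bound :
    ∃ c : ℝ, 0 < c ∧ ∀ κ : ℝ, 1 ≤ κ →
      ∀ lam lam' : ℝ, 0 < lam → lam ≤ 1 → 0 < lam' → lam' ≤ 1 →
        |hhlF κ lam - hhlF κ lam'| ^ 2 + |hhlG κ lam - hhlG κ lam'| ^ 2 ≤
          c * κ ^ 2 * (lam - lam') ^ 2 * (hhlF κ lam ^ 2 + hhlG κ lam ^ 2) := by
  refine ⟨50, by norm_num, fun κ hκ l l' _ _ _ _ => ?_⟩
  rw [hhlF_eq κ l hκ, hhlF_eq κ l' hκ, hhlG_eq κ l hκ, hhlG_eq κ l' hκ]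
  have hT := hhlT_lip (κ * l) (κ * l')
  have hM : |max 1 (κ * l) - max 1 (κ * l')| ≤ |κ * l - κ * l'| := by
    have := abs_max_sub_max_le_max 1 (κ * l) 1 (κ * l')
    simpa using this
  have h1 := hhl_key _ _ _ _ _ ((hhl_sin_lip _ _).trans hT) (Real.abs_sin_le_one _)
    (le_max_left 1 (κ * l)) (le_max_left 1 (κ * l')) hM
  have h2 := hhl_key _ _ _ _ _ ((hhl_cos_lip _ _).trans hT) (Real.abs_cos_le_one _)
    (le_max_left 1 (κ * l)) (le_max_left 1 (κ * l')) hM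
  refine (add_le_add h1 h2).trans (le_of_eq ?_)
  rw [div_pow (Real.sin _), div_pow (Real.cos _), ← add_div, Real.sin_sq_add_cos_sq, sq_abs]
  ring
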